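/- Let X₁,…,X_K (K ≥ 3) be measurable spaces, X = X₁ × ⋯ × X_K, and π a probability measure on X. Assume each subspace E_{{i}} (i = 1,…,K) is a proper subspace of L²(π), and assume r(P_{E_{{1}}}P_{E_{{2}}}⋯P_{E_{{K}}} − Π) < 1 (the full deterministic-scan Gibbs sampler has a spectral gap). Let I be a nonempty proper subset of {1,…,K} such that E_{Iᶜ} is a proper subspace of L²(π), let g ≥ 2, and let J₁,…,J_g be nonempty proper subsets of I with ⋃_{d=1}^g J_d = I; set G_d = E_{J_d}^{(I)} ⊆ L²(π_I) for d = 1,…,g. Then r(P_{G₁}P_{G₂}⋯P_{G_g} − Π_I) < 1, and r(∑_{d=1}^g v_d P_{G_d} − Π_I) < 1 for every (v₁,…,v_g) ∈ 𝒮_g. (Every cycle and mixture of collapsed Gibbs steps inherits a spectral gap from a full Gibbs sampler.) -/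

import Mathlib

open MeasureTheory
open scoped ENNReal

set_option linter.unusedSectionVars false

/-- The orthogonal projection onto a closed subspace, as an operator on the ambient space. -/
noncomputable def proj {H : Type*} [NormedAddCommGroup H] [InnerProductSpace ℂ H]
    [CompleteSpace H] (S : Submodule ℂ H) (hS : IsClosed (S : Set H)) : H →L[ℂ] H :=
  haveI : CompleteSpace S := hS.completeSpace_coe
  S.subtypeL.comp S.orthogonalProjectionOnto

variable {α : Type*} [MeasurableSpace α]

/-- The closed subspace of `L²(μ)` of elements having a representative measurable with respect
to the σ-algebra generated by the map `g` (the functions "depending only on `g`"). -/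
noncomputable def depOn {β : Type*} [mβ : MeasurableSpace β] (μ : Measure α) (g : α → β) :
    Submodule ℂ (Lp ℂ 2 μ) :=
  lpMeas ℂ ℂ (mβ.comap g) 2 μ

lemma isClosed_depOn {β : Type*} [mβ : MeasurableSpace β] (μ : Measure α) {g : α → β}
    (hg : Measurable g) : IsClosed ((depOn μ g : Set (Lp ℂ 2 μ))) := by
  haveI : Fact ((1 : ℝ≥0∞) ≤ 2) := ⟨one_le_two⟩
  exact isClosed_aestronglyMeasurable hg.comap_le

/-- The subspace of (a.e.) constant functions in `L²(μ)`: the span of the constant function 1. -/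
noncomputable def constSub (μ : Measure α) [IsFiniteMeasure μ] : Submodule ℂ (Lp ℂ 2 μ) :=
  Submodule.span ℂ {MemLp.toLp (fun _ => (1 : ℂ)) (memLp_const (1 : ℂ))}

lemma isClosed_constSub (μ : Measure α) [IsFiniteMeasure μ] :
    IsClosed ((constSub μ : Set (Lp ℂ 2 μ))) := by
  haveI : FiniteDimensional ℂ (constSub μ) :=
    FiniteDimensional.span_singleton (K := ℂ) (MemLp.toLp (fun _ => (1 : ℂ)) (memLp_const (1 : ℂ)))
  exact Submodule.closed_of_finiteDimensional _

section Product

variable {K : ℕ} {X : Fin K → Type*} [∀ i, MeasurableSpace (X i)]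

/-- Restriction of a point of the product space to the coordinates lying outside `S`. -/
def restOut (S : Finset (Fin K)) (x : ∀ i, X i) : ∀ i : {i : Fin K // i ∉ S}, X i.val :=
  fun i => x i.val

lemma measurable_restOut (S : Finset (Fin K)) : Measurable (restOut (X := X) S) :=
  measurable_pi_lambda _ fun i => measurable_pi_apply i.val

/-- Restriction of a point of the product space to the coordinates lying in `I`
(the map `x ↦ x_I`). -/
def restIn (I : Finset (Fin K)) (x : ∀ i, X i) : ∀ i : {i : Fin K // i ∈ I}, X i.val :=
  fun i => x i.val

lemma measurable_restIn (I : Finset (Fin K)) : Measurable (restIn (X := X) I) :=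
  measurable_pi_lambda _ fun i => measurable_pi_apply i.val

/-- Restriction of a point of the marginal space `X_I` to the coordinates lying outside `S`. -/
def restOutIn (I S : Finset (Fin K)) (y : ∀ i : {i : Fin K // i ∈ I}, X i.val) :
    ∀ j : {i : {i : Fin K // i ∈ I} // i.val ∉ S}, X j.val.val :=
  fun j => y j.val

lemma measurable_restOutIn (I S : Finset (Fin K)) : Measurable (restOutIn (X := X) I S) :=
  measurable_pi_lambda _ fun j => measurable_pi_apply j.val


section Abstract

variable {H : Type*} [NormedAddCommGroup H] [InnerProductSpace ℂ H] [CompleteSpace H]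

lemma proj_mem (S : Submodule ℂ H) (hS : IsClosed (S : Set H)) (f : H) : proj S hS f ∈ S := by
  unfold proj
  exact Subtype.mem _

lemma proj_pyth (S : Submodule ℂ H) (hS : IsClosed (S : Set H)) (f : H) :
    ‖f‖ ^ 2 = ‖proj S hS f‖ ^ 2 + ‖f - proj S hS f‖ ^ 2 := by
  have : CompleteSpace S := hS.completeSpace_coe
  have h := Submodule.norm_sq_eq_add_norm_sq_starProjection f S
  rw [Submodule.starProjection_orthogonal_val] at h
  exact h

lemma proj_min (S : Submodule ℂ H) (hS : IsClosed (S : Set H)) (f y : H) (hy : y ∈ S) :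
    ‖f - proj S hS f‖ ≤ ‖f - y‖ := by
  have : CompleteSpace S := hS.completeSpace_coe
  have h := Submodule.starProjection_minimal (U := S) f
  have h2 : ‖f - proj S hS f‖ = ⨅ x : S, ‖f - x‖ := h
  rw [h2]
  exact ciInf_le ⟨0, by rintro _ ⟨x, rfl⟩; exact norm_nonneg _⟩ (⟨y, hy⟩ : S)

lemma proj_eq_self (S : Submodule ℂ H) (hS : IsClosed (S : Set H)) (f : H) (hf : f ∈ S) :
    proj S hS f = f := by
  have h := proj_min S hS f f hf
  rw [sub_self, norm_zero] at h
  exact (sub_eq_zero.1 (norm_le_zero_iff.1 h)).symm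

lemma proj_eq_zero_iff (S : Submodule ℂ H) (hS : IsClosed (S : Set H)) (f : H) :
    proj S hS f = 0 ↔ f ∈ Sᗮ := by
  have : CompleteSpace S := hS.completeSpace_coe
  have : proj S hS f = S.starProjection f := rfl
  rw [this]
  exact Submodule.starProjection_apply_eq_zero_iff S

/-- The two properties of orthogonal projections that we use. -/
def OP (P : H →L[ℂ] H) : Prop :=
  ∀ f h : H, ‖f‖ ^ 2 = ‖P f‖ ^ 2 + ‖f - P f‖ ^ 2 ∧ ‖f - P f‖ ≤ ‖f - P h‖

lemma op_proj (S : Submodule ℂ H) (hS : IsClosed (S : Set H)) : OP (proj S hS) :=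
  fun f h => ⟨proj_pyth S hS f, proj_min S hS f _ (proj_mem S hS h)⟩

lemma OP.norm_le {P : H →L[ℂ] H} (hP : OP P) (f : H) : ‖P f‖ ≤ ‖f‖ := by
  have := (hP f f).1
  exact (abs_le_of_sq_le_sq' (by nlinarith [sq_nonneg ‖f - P f‖]) (norm_nonneg _)).2

lemma list_prod_norm_le (L : List (H →L[ℂ] H)) (hL : ∀ P ∈ L, OP P) (f : H) :
    ‖L.prod f‖ ≤ ‖f‖ := by
  induction L with
  | nil => simp
  | cons P L ih =>
    rw [List.prod_cons, mul_apply_eq_comp]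
    exact ((hL P (by simp)).norm_le _).trans (ih fun Q hQ => hL Q (by simp [hQ]))

lemma list_prod_sub_le (L : List (H →L[ℂ] H)) (hL : ∀ P ∈ L, OP P) (f : H) :
    ‖f - L.prod f‖ ≤ (L.map fun P => ‖f - P f‖).sum := by
  induction L with
  | nil => simp
  | cons P L ih =>
    rw [List.prod_cons, mul_apply_eq_comp, List.map_cons, List.sum_cons]
    have h1 := ih fun Q hQ => hL Q (by simp [hQ])
    have h2 : f - P (L.prod f) = (f - P f) + P (f - L.prod f) := by rw [map_sub]; abel
    rw [h2]
    refine (norm_add_le _ _).trans ?_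
    have := (hL P (by simp)).norm_le (f - L.prod f)
    linarith

lemma list_prod_steps (L : List (H →L[ℂ] H)) (hL : ∀ P ∈ L, OP P) (f : H) (e : ℝ) (he : 0 ≤ e)
    (h : ‖f‖ ^ 2 - ‖L.prod f‖ ^ 2 ≤ e ^ 2) :
    ‖f - L.prod f‖ ≤ L.length * e ∧ ∀ P ∈ L, ‖f - P f‖ ≤ L.length * e := by
  induction L with
  | nil => simp
  | cons P L ih =>
    rw [List.prod_cons, mul_apply_eq_comp] at h ⊢
    have hP := hL P (by simp)
    have hL' : ∀ Q ∈ L, OP Q := fun Q hQ => hL Q (by simp [hQ])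
    set u := L.prod f with hu
    have h1 := (hP u u).1
    have h2 := list_prod_norm_le L hL' f
    rw [← hu] at h2
    have h3 : ‖u‖ ^ 2 ≤ ‖f‖ ^ 2 := by gcongr
    obtain ⟨i1, i2⟩ := ih hL' (by nlinarith [sq_nonneg ‖u - P u‖])
    have h4 : ‖u - P u‖ ≤ e := abs_le_of_sq_le_sq' (by linarith) he |>.2
    have h5 : ‖f - P u‖ ≤ (L.length + 1) * e := by
      have : f - P u = (f - u) + (u - P u) := by abel
      rw [this]
      refine (norm_add_le _ _).trans ?_
      linarith
    have hlen : (((P :: L).length : ℕ) : ℝ) = L.length + 1 := by simp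
    rw [hlen]
    refine ⟨h5, ?_⟩
    intro Q hQ
    rcases List.mem_cons.1 hQ with rfl | hQ
    · exact (hP f u).2.trans h5
    · have := i2 Q hQ
      linarith

lemma spectralRadius_lt_one_of (A : H →L[ℂ] H) (q : ℝ) (hq : q < 1)
    (h : ∀ f, ‖A f‖ ^ 2 ≤ q * ‖f‖ ^ 2) : spectralRadius ℂ A < 1 := by
  rcases subsingleton_or_nontrivial H with hH | hH
  · have : spectralRadius ℂ A = 0 := by
      have : Subsingleton (H →L[ℂ] H) := ⟨fun a b => by ext x; exact Subsingleton.elim _ _⟩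
      simp [spectralRadius]
    rw [this]; exact zero_lt_one
  · refine (spectrum.spectralRadius_le_nnnorm A).trans_lt ?_
    have hn : ‖A‖ ≤ Real.sqrt q := by
      refine ContinuousLinearMap.opNorm_le_bound _ (Real.sqrt_nonneg _) fun f => ?_
      by_cases hf : f = 0
      · simp [hf]
      have hf0 : 0 < ‖f‖ ^ 2 := by positivity
      have hq0 : 0 ≤ q := by
        have := h f
        by_contra hc
        nlinarith [sq_nonneg ‖A f‖]
      refine abs_le_of_sq_le_sq' ?_ (by positivity) |>.2
      rw [mul_pow, Real.sq_sqrt hq0]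
      exact h f
    have h1 : ‖A‖ < 1 := hn.trans_lt (by rw [Real.sqrt_lt' one_pos]; simpa using hq)
    exact_mod_cast (show ‖A‖₊ < 1 from h1)

lemma spectralRadius_sub_lt (C : Submodule ℂ H) (hC : IsClosed (C : Set H)) (T : H →L[ℂ] H)
    (hT : ∀ f ∈ C, T f = f) (q : ℝ) (hq : q < 1) (hq0 : 0 ≤ q)
    (h : ∀ f, proj C hC f = 0 → ‖T f‖ ^ 2 ≤ q * ‖f‖ ^ 2) :
    spectralRadius ℂ (T - proj C hC) < 1 := by
  refine spectralRadius_lt_one_of _ q hq fun f => ?_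
  have h1 : (T - proj C hC) f = T (f - proj C hC f) := by
    rw [map_sub, hT _ (proj_mem C hC f)]; rfl
  rw [h1]
  refine (h _ ?_).trans ?_
  · rw [map_sub, proj_eq_self C hC _ (proj_mem C hC f), sub_self]
  · have := proj_pyth C hC f
    gcongr
    exact (abs_le_of_sq_le_sq' (by nlinarith [sq_nonneg ‖proj C hC f‖]) (norm_nonneg _)).2

lemma ratio_aux {D x y : ℝ} (hD : 1 ≤ D) (h : x ≤ D * (x - y)) : y ≤ (1 - 1 / D) * x := by
  have hD0 : 0 < D := by linarith
  have : x / D ≤ x - y := by rw [div_le_iff₀ hD0]; linarith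
  have h2 : (1 - 1 / D) * x = x - x / D := by field_simp
  linarith

lemma ratio_bounds {D : ℝ} (hD : 1 ≤ D) : 1 - 1 / D < 1 ∧ 0 ≤ 1 - 1 / D := by
  have hD0 : 0 < D := by linarith
  constructor
  · have : 0 < 1 / D := by positivity
    linarith
  · have : 1 / D ≤ 1 := by rw [div_le_one hD0]; exact hD
    linarith

lemma abs_prod {g : ℕ} (C : Submodule ℂ H) (hC : IsClosed (C : Set H))
    (P : Fin g → H →L[ℂ] H) (hP : ∀ d, OP (P d)) (hPC : ∀ d, ∀ f ∈ C, P d f = f)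
    (c : ℝ) (hc : 0 ≤ c)
    (h : ∀ f, proj C hC f = 0 → ‖f‖ ≤ c * ∑ d, ‖f - P d f‖) :
    spectralRadius ℂ ((List.ofFn P).prod - proj C hC) < 1 := by
  have hL : ∀ Q ∈ List.ofFn P, OP Q := by
    intro Q hQ
    obtain ⟨d, rfl⟩ := (List.mem_ofFn' _ _).1 hQ
    exact hP d
  set D : ℝ := (c * (g * g)) ^ 2 + 1 with hD
  have hD1 : 1 ≤ D := by nlinarith [sq_nonneg (c * ((g : ℝ) * g))]
  refine spectralRadius_sub_lt C hC _ ?_ (1 - 1 / D) (ratio_bounds hD1).1 (ratio_bounds hD1).2 ?_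
  · intro f hf
    have h1 := list_prod_sub_le _ hL f
    have h2 : ((List.ofFn P).map fun Q => ‖f - Q f‖).sum = 0 := by
      rw [List.map_ofFn, List.sum_ofFn]
      exact Finset.sum_eq_zero fun d _ => by simp [hPC d f hf]
    rw [h2] at h1
    exact (sub_eq_zero.1 (norm_le_zero_iff.1 h1)).symm
  · intro f hf
    have hn := list_prod_norm_le _ hL f
    have hn2 : 0 ≤ ‖f‖ ^ 2 - ‖(List.ofFn P).prod f‖ ^ 2 := by
      have : ‖(List.ofFn P).prod f‖ ^ 2 ≤ ‖f‖ ^ 2 := by gcongr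
      linarith
    set e := Real.sqrt (‖f‖ ^ 2 - ‖(List.ofFn P).prod f‖ ^ 2) with he
    have hes : e ^ 2 = ‖f‖ ^ 2 - ‖(List.ofFn P).prod f‖ ^ 2 := Real.sq_sqrt hn2
    have h1 := (list_prod_steps _ hL f e (Real.sqrt_nonneg _) hes.ge).2
    rw [List.length_ofFn] at h1
    have h2 : ∑ d, ‖f - P d f‖ ≤ g * (g * e) := by
      refine (Finset.sum_le_card_nsmul Finset.univ _ (g * e) fun d _ =>
        h1 (P d) ((List.mem_ofFn' _ _).2 ⟨d, rfl⟩)).trans ?_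
      simp
    have h3 : ‖f‖ ≤ c * (g * g) * e := (h f hf).trans (by nlinarith)
    have h4 : ‖f‖ ^ 2 ≤ (c * (g * g) * e) ^ 2 := by gcongr
    apply ratio_aux hD1
    rw [← hes, hD]
    nlinarith [sq_nonneg e]

lemma sq_sum_aux {g : ℕ} (v : Fin g → ℝ) (hv : ∀ d, 0 < v d)
    (hv1 : ∑ d, v d = 1) (a : Fin g → ℝ) : (∑ d, v d * a d) ^ 2 ≤ ∑ d, v d * a d ^ 2 := by
  have := Finset.sum_sq_le_sum_mul_sum_of_sq_eq_mul Finset.univ (r := fun d => v d * a d)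
    (f := v) (g := fun d => v d * a d ^ 2) (fun d _ => (hv d).le)
    (fun d _ => by have := hv d; positivity) (fun d _ => by ring)
  rwa [hv1, one_mul] at this

lemma abs_mix {g : ℕ} (C : Submodule ℂ H) (hC : IsClosed (C : Set H))
    (P : Fin g → H →L[ℂ] H) (hP : ∀ d, OP (P d)) (hPC : ∀ d, ∀ f ∈ C, P d f = f)
    (c : ℝ) (hc : 0 ≤ c)
    (h : ∀ f, proj C hC f = 0 → ‖f‖ ≤ c * ∑ d, ‖f - P d f‖)
    (v : Fin g → ℝ) (hv : ∀ d, 0 < v d) (hv1 : ∑ d, v d = 1) :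
    spectralRadius ℂ ((∑ d, (v d : ℂ) • P d) - proj C hC) < 1 := by
  have happ : ∀ f, (∑ d, (v d : ℂ) • P d) f = ∑ d, (v d : ℂ) • P d f := by
    intro f; simp
  set D : ℝ := c ^ 2 * ∑ d, 1 / v d + 1 with hD
  have hDs : 0 ≤ ∑ d, 1 / v d := Finset.sum_nonneg fun d _ => by have := hv d; positivity
  have hD1 : 1 ≤ D := by nlinarith [sq_nonneg c, mul_nonneg (sq_nonneg c) hDs]
  refine spectralRadius_sub_lt C hC _ ?_ (1 - 1 / D) (ratio_bounds hD1).1 (ratio_bounds hD1).2 ?_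
  · intro f hf
    rw [happ]
    simp_rw [hPC _ f hf]
    rw [← Finset.sum_smul]
    norm_cast
    rw [hv1]; simp
  · intro f hf
    have hs : ‖(∑ d, (v d : ℂ) • P d) f‖ ^ 2 ≤ ∑ d, v d * ‖P d f‖ ^ 2 := by
      rw [happ]
      have h1 : ‖∑ d, (v d : ℂ) • P d f‖ ≤ ∑ d, v d * ‖P d f‖ := by
        refine (norm_sum_le _ _).trans (Finset.sum_le_sum fun d _ => ?_)
        rw [norm_smul, Complex.norm_real, Real.norm_of_nonneg (hv d).le]
      have h2 : (∑ d, v d * ‖P d f‖) ^ 2 ≤ ∑ d, v d * ‖P d f‖ ^ 2 :=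
        sq_sum_aux v hv hv1 fun d => ‖P d f‖
      refine le_trans ?_ h2
      gcongr
    have hs2 : ∑ d, v d * ‖P d f‖ ^ 2 = ‖f‖ ^ 2 - ∑ d, v d * ‖f - P d f‖ ^ 2 := by
      rw [eq_sub_iff_add_eq, ← Finset.sum_add_distrib]
      simp_rw [← mul_add, ← (hP _ f f).1]
      rw [← Finset.sum_mul, hv1, one_mul]
    have hcs : (∑ d, ‖f - P d f‖) ^ 2 ≤ (∑ d, 1 / v d) * ∑ d, v d * ‖f - P d f‖ ^ 2 := by
      refine Finset.sum_sq_le_sum_mul_sum_of_sq_eq_mul _ (fun d _ => ?_) (fun d _ => ?_)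
        (fun d _ => ?_)
      · have := hv d; positivity
      · have := hv d; positivity
      · have := (hv d).ne'
        field_simp
    have h4 : ‖f‖ ^ 2 ≤ (c * ∑ d, ‖f - P d f‖) ^ 2 := by
      have := h f hf
      gcongr
    have h5 : 0 ≤ ∑ d, v d * ‖f - P d f‖ ^ 2 :=
      Finset.sum_nonneg fun d _ => by have := hv d; positivity
    apply ratio_aux hD1
    have h6 : ‖f‖ ^ 2 ≤ D * ∑ d, v d * ‖f - P d f‖ ^ 2 := by
      rw [mul_pow] at h4
      have := mul_le_mul_of_nonneg_left hcs (sq_nonneg c)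
      rw [hD]
      nlinarith
    refine h6.trans ?_
    gcongr
    linarith

/-- A spectral gap for the product gives a linear bound. -/
lemma gap_bound {k : ℕ} (C : Submodule ℂ H) (hC : IsClosed (C : Set H))
    (P : Fin k → H →L[ℂ] H) (hP : ∀ d, OP (P d))
    (hgap : spectralRadius ℂ ((List.ofFn P).prod - proj C hC) < 1) :
    ∃ c : ℝ, 0 ≤ c ∧ ∀ f, proj C hC f = 0 → ‖f‖ ≤ c * ∑ d, ‖f - P d f‖ := by
  have hL : ∀ Q ∈ List.ofFn P, OP Q := by
    intro Q hQ
    obtain ⟨d, rfl⟩ := (List.mem_ofFn' _ _).1 hQ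
    exact hP d
  set A := (List.ofFn P).prod - proj C hC with hA
  have h1 : (1 : ℂ) ∈ resolventSet ℂ A :=
    spectrum.mem_resolventSet_of_spectralRadius_lt (by simpa using hgap)
  rw [spectrum.mem_resolventSet_iff, map_one] at h1
  obtain ⟨u, hu⟩ := h1
  refine ⟨‖(↑u⁻¹ : H →L[ℂ] H)‖, norm_nonneg _, fun f hf => ?_⟩
  have h2 : f = (↑u⁻¹ : H →L[ℂ] H) (f - (List.ofFn P).prod f) := by
    have h3 : (1 - A) f = f - (List.ofFn P).prod f := by
      rw [hA]; simp [hf]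
    rw [← h3, ← hu, ← mul_apply_eq_comp, Units.inv_mul]; rfl
  have h4 := list_prod_sub_le _ hL f
  rw [List.map_ofFn, List.sum_ofFn] at h4
  calc ‖f‖ = ‖(↑u⁻¹ : H →L[ℂ] H) (f - (List.ofFn P).prod f)‖ := by rw [← h2]
    _ ≤ ‖(↑u⁻¹ : H →L[ℂ] H)‖ * ‖f - (List.ofFn P).prod f‖ := ContinuousLinearMap.le_opNorm _ _
    _ ≤ _ := by gcongr; exact h4

end Abstract

lemma lift_mem_aux {α β γ δ : Type*} [MeasurableSpace α] [MeasurableSpace β]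
    [mγ : MeasurableSpace γ] [mδ : MeasurableSpace δ] {μ : Measure α} {ν : Measure β}
    {r : α → β} (hr : MeasurePreserving r μ ν) (s : β → γ) (t : α → δ) (w : δ → γ)
    (hw : Measurable w) (hst : ∀ x, s (r x) = w (t x))
    (f : Lp ℂ 2 ν) (hf : f ∈ depOn ν s) :
    Lp.compMeasurePreserving r hr f ∈ depOn μ t := by
  unfold depOn at hf ⊢
  rw [mem_lpMeas_iff_aestronglyMeasurable] at hf ⊢
  obtain ⟨f', hf', hff'⟩ := hf
  refine ⟨f' ∘ r, ?_, ?_⟩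
  · refine hf'.comp_measurable ?_
    rw [measurable_comap_iff]
    have : s ∘ r = w ∘ t := funext hst
    rw [this]
    exact hw.comp (comap_measurable t)
  · exact (Lp.coeFn_compMeasurePreserving f hr).trans
      (hr.quasiMeasurePreserving.ae_eq_comp hff')

lemma mem_depOn_id {α : Type*} [MeasurableSpace α] {μ : Measure α} (f : Lp ℂ 2 μ) :
    f ∈ depOn μ (id : α → α) := by
  unfold depOn
  rw [MeasurableSpace.comap_id]
  exact mem_lpMeas_self μ f

lemma const_le_depOn {α β : Type*} [MeasurableSpace α] [MeasurableSpace β] (μ : Measure α)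
    [IsFiniteMeasure μ] (s : α → β) : constSub μ ≤ depOn μ s := by
  unfold constSub
  rw [Submodule.span_le, Set.singleton_subset_iff]
  unfold depOn
  rw [SetLike.mem_coe, mem_lpMeas_iff_aestronglyMeasurable]
  exact ⟨fun _ => 1, stronglyMeasurable_const, MemLp.coeFn_toLp _⟩

lemma lift_const {α β : Type*} [MeasurableSpace α] [MeasurableSpace β] {μ : Measure α}
    {ν : Measure β} [IsFiniteMeasure μ] [IsFiniteMeasure ν] {r : α → β}
    (hr : MeasurePreserving r μ ν) (f : Lp ℂ 2 ν)
    (hf : proj (constSub ν) (isClosed_constSub ν) f = 0) :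
    proj (constSub μ) (isClosed_constSub μ) (Lp.compMeasurePreserving r hr f) = 0 := by
  rw [proj_eq_zero_iff] at hf ⊢
  unfold constSub at hf ⊢
  rw [Submodule.mem_orthogonal_singleton_iff_inner_right] at hf ⊢
  rw [← hf]
  exact (Lp.compMeasurePreservingₗᵢ ℂ r hr).inner_map_map
    (MemLp.toLp (fun _ => (1 : ℂ)) (memLp_const (1 : ℂ))) f


/-- If the full deterministic-scan Gibbs sampler on `L²(π)` has a spectral
gap, then every cycle and mixture of collapsed Gibbs steps on `L²(π_I)` has a spectral gap. -/
theorem collapsed_inherits_spectral_gap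
    (hK : 3 ≤ K) (π : Measure (∀ i, X i)) [IsProbabilityMeasure π]
    (hEproper : ∀ i : Fin K, depOn π (restOut {i}) ≠ ⊤)
    (hgap : spectralRadius ℂ
      ((List.ofFn fun i : Fin K =>
          proj (depOn π (restOut {i})) (isClosed_depOn π (measurable_restOut _))).prod
        - proj (constSub π) (isClosed_constSub π)) < 1)
    (I : Finset (Fin K)) (hIne : I.Nonempty) (hIproper : I ≠ Finset.univ)
    (hEIc : depOn π (restOut Iᶜ) ≠ ⊤)
    {g : ℕ} (hg : 2 ≤ g) (J : Fin g → Finset (Fin K))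
    (hJne : ∀ d, (J d).Nonempty) (hJproper : ∀ d, J d ⊂ I)
    (hJcover : ∀ i ∈ I, ∃ d, i ∈ J d) :
    haveI : IsProbabilityMeasure (π.map (restIn I)) :=
      Measure.isProbabilityMeasure_map (measurable_restIn I).aemeasurable
    (spectralRadius ℂ
        ((List.ofFn fun d =>
            proj (depOn (π.map (restIn I)) (restOutIn I (J d)))
              (isClosed_depOn _ (measurable_restOutIn I (J d)))).prod
          - proj (constSub (π.map (restIn I))) (isClosed_constSub _)) < 1) ∧
    ∀ v : Fin g → ℝ, (∀ d, 0 < v d) → ∑ d, v d = 1 →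
      haveI : IsProbabilityMeasure (π.map (restIn I)) :=
        Measure.isProbabilityMeasure_map (measurable_restIn I).aemeasurable
      spectralRadius ℂ
          ((∑ d, (v d : ℂ) •
              proj (depOn (π.map (restIn I)) (restOutIn I (J d)))
                (isClosed_depOn _ (measurable_restOutIn I (J d))))
            - proj (constSub (π.map (restIn I))) (isClosed_constSub _)) < 1 := by
  haveI hprob : IsProbabilityMeasure (π.map (restIn I)) :=
    Measure.isProbabilityMeasure_map (measurable_restIn I).aemeasurable
  have hr : MeasurePreserving (restIn (X := X) I) π (π.map (restIn I)) :=
    (measurable_restIn I).measurePreserving π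
  obtain ⟨c, hc, hb⟩ := gap_bound (constSub π) (isClosed_constSub π) _
    (fun i : Fin K => op_proj _ (isClosed_depOn π (measurable_restOut {i}))) hgap
  have key : ∀ f : Lp ℂ 2 (π.map (restIn I)),
      proj (constSub (π.map (restIn I))) (isClosed_constSub _) f = 0 →
      ‖f‖ ≤ (c * K) * ∑ d, ‖f - proj (depOn (π.map (restIn I)) (restOutIn I (J d)))
              (isClosed_depOn _ (measurable_restOutIn I (J d))) f‖ := by
    intro f hf
    set R := ∑ d, ‖f - proj (depOn (π.map (restIn I)) (restOutIn I (J d)))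
              (isClosed_depOn _ (measurable_restOutIn I (J d))) f‖ with hR
    have hR0 : 0 ≤ R := Finset.sum_nonneg fun d _ => norm_nonneg _
    have h1 := hb _ (lift_const hr f hf)
    rw [Lp.norm_compMeasurePreserving] at h1
    refine h1.trans ?_
    rw [mul_assoc]
    refine mul_le_mul_of_nonneg_left ?_ hc
    refine (Finset.sum_le_card_nsmul Finset.univ _ R fun i _ => ?_).trans (by simp)
    by_cases hi : i ∈ I
    · obtain ⟨d, hd⟩ := hJcover i hi
      set y := proj (depOn (π.map (restIn I)) (restOutIn I (J d)))
              (isClosed_depOn _ (measurable_restOutIn I (J d))) f with hy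
      have hmem : Lp.compMeasurePreserving (restIn (X := X) I) hr y ∈ depOn π (restOut {i}) := by
        refine lift_mem_aux hr (restOutIn I (J d)) (restOut {i})
          (fun z j => z ⟨j.val.val, fun h => j.2 (by rw [Finset.mem_singleton.1 h]; exact hd)⟩)
          (measurable_pi_lambda _ fun j => measurable_pi_apply _) (fun x => rfl) y
          (proj_mem _ _ _)
      refine (proj_min _ (isClosed_depOn π (measurable_restOut {i})) _ _ hmem).trans ?_
      rw [← map_sub, Lp.norm_compMeasurePreserving]
      exact Finset.single_le_sum (f := fun d => ‖f - proj (depOn (π.map (restIn I))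
        (restOutIn I (J d))) (isClosed_depOn _ (measurable_restOutIn I (J d))) f‖)
        (fun d _ => norm_nonneg _) (Finset.mem_univ d)
    · have hmem : Lp.compMeasurePreserving (restIn (X := X) I) hr f ∈ depOn π (restOut {i}) := by
        refine lift_mem_aux hr id (restOut {i})
          (fun z j => z ⟨j.val, fun h => hi (by rw [← Finset.mem_singleton.1 h]; exact j.2)⟩)
          (measurable_pi_lambda _ fun j => measurable_pi_apply _) (fun x => rfl) f
          (mem_depOn_id f)
      rw [proj_eq_self _ _ _ hmem, sub_self, norm_zero]
      exact hR0
  have hPC : ∀ d, ∀ f ∈ constSub (π.map (restIn I)),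
      proj (depOn (π.map (restIn I)) (restOutIn I (J d)))
        (isClosed_depOn _ (measurable_restOutIn I (J d))) f = f :=
    fun d f hf => proj_eq_self _ _ _ (const_le_depOn _ _ hf)
  have hcK : 0 ≤ c * K := by positivity
  refine ⟨abs_prod _ _ _ (fun d => op_proj _ _) hPC (c * K) hcK key, fun v hv hv1 => ?_⟩
  exact abs_mix _ _ _ (fun d => op_proj _ _) hPC (c * K) hcK key v hv hv1
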